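/- arXiv:2008.08381 — 3 statements merged into one kernel-verified Lean document; each statement's English description precedes it below -/
import Mathlib

section
/- Let f = (u, p) : X^m → Y^n be a multiset mapping with u surjective and p a bijection from m* onto n*, and let A ∈ X^m. Then (f(A))ᶜ ⊆ f(Aᶜ), i.e. for every y ∈ Y, n − f(A)(y) ≤ f(Aᶜ)(y). -/
/-- The image of a multiset (count function) `A` under a multiset mapping
`f = (u, p)`: `f(A)(y) = p (sup {A x : u x = y})`, with `sup ∅ = 0` in ℕ. -/
noncomputable def msImage {X Y : Type*} (u : X → Y) (p : ℕ → ℕ) (A : X → ℕ) : Y → ℕ :=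
  fun y => p (sSup (A '' (u ⁻¹' {y})))

/-- A monotone bijection from `{0, ..., m}` onto `{0, ..., n}` fixing `0` is the identity. -/
theorem eq_self_of_monotone_bijection {m n : ℕ} {p : ℕ → ℕ} (hp0 : p 0 = 0)
    (hmono : ∀ i j, i ≤ j → j ≤ m → p i ≤ p j)
    (hbd : ∀ i, i ≤ m → p i ≤ n)
    (hpinj : ∀ i, i ≤ m → ∀ j, j ≤ m → p i = p j → i = j)
    (hpsurj : ∀ j, j ≤ n → ∃ i, i ≤ m ∧ p i = j) (i : ℕ) (hi : i ≤ m) : p i = i := by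
  induction i with
  | zero => exact hp0
  | succ i ih =>
    have hpi := ih (by omega)
    have hle := hmono i (i + 1) (by omega) hi
    have hne : p i ≠ p (i + 1) := fun h => by
      have := hpinj i (by omega) (i + 1) hi h
      omega
    have hn := hbd (i + 1) hi
    obtain ⟨k, hk, hpk⟩ := hpsurj (i + 1) (by omega)
    rcases Nat.lt_or_ge i k with h | h
    · have := hmono (i + 1) k h hk
      omega
    · have := hmono k i h (by omega)
      omega

/-- For a multiset mapping `f = (u, p) : X^m → Y^n` with `u`
surjective and `p` a bijection from `m*` onto `n*`, and `A ∈ X^m`: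
`(f(A))ᶜ ⊆ f(Aᶜ)`, i.e. `∀ y, n − f(A)(y) ≤ f(Aᶜ)(y)`. -/
theorem stmt_8 {X Y : Type*} (m n : ℕ) (u : X → Y) (p : ℕ → ℕ)
    (hp0 : p 0 = 0) (hpm : p m = n)
    (hmono : ∀ i j, i ≤ j → j ≤ m → p i ≤ p j)
    (hbd : ∀ i, i ≤ m → p i ≤ n)
    (husurj : Function.Surjective u)
    (hpinj : ∀ i, i ≤ m → ∀ j, j ≤ m → p i = p j → i = j)
    (hpsurj : ∀ j, j ≤ n → ∃ i, i ≤ m ∧ p i = j)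
    (A : X → ℕ) (hA : ∀ x, A x ≤ m) :
    ∀ y : Y, n - msImage u p A y ≤ msImage u p (fun x => m - A x) y := by
  have hp := eq_self_of_monotone_bijection hp0 hmono hbd hpinj hpsurj
  have hmn : n = m := hpm.symm.trans (hp m le_rfl)
  intro y
  obtain ⟨x, hx⟩ := husurj y
  have hne (B : X → ℕ) : (B '' (u ⁻¹' {y})).Nonempty := ⟨B x, x, hx, rfl⟩
  have hsup (B : X → ℕ) (hB : ∀ x, B x ≤ m) : sSup (B '' (u ⁻¹' {y})) ≤ m :=
    csSup_le (hne B) (by rintro _ ⟨z, -, rfl⟩; exact hB z)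
  have hle (B : X → ℕ) (hB : ∀ x, B x ≤ m) : B x ≤ sSup (B '' (u ⁻¹' {y})) :=
    le_csSup ⟨m, by rintro _ ⟨z, -, rfl⟩; exact hB z⟩ ⟨x, hx, rfl⟩
  have hAc : ∀ x, m - A x ≤ m := fun x => Nat.sub_le m (A x)
  unfold msImage
  rw [hp _ (hsup A hA), hp _ (hsup _ hAc), hmn]
  exact (Nat.sub_le_sub_left (hle A hA) m).trans (hle (fun x => m - A x) hAc)
end

section
/- Let f = (u, p) : X^m → Y^n be a multiset mapping and M, N ∈ Y^n. Then f⁻¹(M) ∩ f⁻¹(N) ⊆ f⁻¹(M ∩ N); moreover, if p maps m* onto n* then f⁻¹(M) ∩ f⁻¹(N) = f⁻¹(M ∩ N). -/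
/-- The preimage of a multiset (count function) `M` under a multiset mapping
`f = (u, p) : X^m → Y^n`: `f⁻¹(M)(x) = sup {i ∈ m* : p i = M (u x)}`, with `sup ∅ = 0`. -/
noncomputable def msPreimage {X Y : Type*} (m : ℕ) (u : X → Y) (p : ℕ → ℕ) (M : Y → ℕ) : X → ℕ :=
  fun x => sSup {i : ℕ | i ≤ m ∧ p i = M (u x)}

/-- Suprema of fibres of a map that is monotone on `{0, …, m}` are monotone in the value,
provided the fibre over the larger value is nonempty. -/
theorem sSup_fibre_le_sSup_fibre {m : ℕ} {p : ℕ → ℕ}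
    (hmono : ∀ i j, i ≤ j → j ≤ m → p i ≤ p j) {a b : ℕ} (hab : a ≤ b)
    (hb : ∃ i, i ≤ m ∧ p i = b) :
    sSup {i : ℕ | i ≤ m ∧ p i = a} ≤ sSup {i : ℕ | i ≤ m ∧ p i = b} := by
  obtain rfl | hlt := hab.eq_or_lt
  · exact le_rfl
  obtain ⟨j, hjm, hj⟩ := hb
  have hjle : j ≤ sSup {i : ℕ | i ≤ m ∧ p i = b} :=
    le_csSup ⟨m, fun i hi => hi.1⟩ ⟨hjm, hj⟩
  refine csSup_le' fun k hk => le_trans ?_ hjle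
  by_contra! hjk
  have := hmono j k hjk.le hk.1
  have := hk.2
  omega

/-- For a multiset mapping `f = (u, p) : X^m → Y^n` and `M, N ∈ Y^n`,
`f⁻¹(M) ∩ f⁻¹(N) ⊆ f⁻¹(M ∩ N)`; if moreover `p` maps `m*` onto `n*`, then
`f⁻¹(M) ∩ f⁻¹(N) = f⁻¹(M ∩ N)`. -/
theorem stmt_11 {X Y : Type*} (m n : ℕ) (u : X → Y) (p : ℕ → ℕ)
    (hp0 : p 0 = 0) (hpm : p m = n)
    (hmono : ∀ i j, i ≤ j → j ≤ m → p i ≤ p j)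
    (hbd : ∀ i, i ≤ m → p i ≤ n)
    (M N : Y → ℕ) (hM : ∀ y, M y ≤ n) (hN : ∀ y, N y ≤ n) :
    (∀ x : X, min (msPreimage m u p M x) (msPreimage m u p N x)
        ≤ msPreimage m u p (fun y => min (M y) (N y)) x) ∧
    ((∀ j, j ≤ n → ∃ i, i ≤ m ∧ p i = j) →
      ∀ x : X, min (msPreimage m u p M x) (msPreimage m u p N x)
        = msPreimage m u p (fun y => min (M y) (N y)) x) := by
  refine ⟨fun x => ?_, fun hsurj x => ?_⟩
  · rcases le_total (M (u x)) (N (u x)) with h | h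
    · simp [msPreimage, h]
    · simp [msPreimage, h]
  · rcases le_total (M (u x)) (N (u x)) with h | h
    · simpa [msPreimage, h] using
        sSup_fibre_le_sSup_fibre hmono h (hsurj _ (hN (u x)))
    · simpa [msPreimage, h] using
        sSup_fibre_le_sSup_fibre hmono h (hsurj _ (hM (u x)))
end

section
/- Let f = (u, p) : X^m → Y^n be a multiset mapping with p a bijection from m* onto n*, and let M ∈ Y^n. Then f⁻¹(Mᶜ) = (f⁻¹(M))ᶜ, i.e. for every x ∈ X, f⁻¹(Mᶜ)(x) = m − f⁻¹(M)(x), where Mᶜ(y) = n − M(y). -/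
/-- A monotone bijection from `{0, …, m}` onto `{0, …, n}` fixing `0` is the identity. -/
theorem eq_self_of_monotone_bijective {m n : ℕ} {p : ℕ → ℕ} (hp0 : p 0 = 0)
    (hmono : ∀ i j, i ≤ j → j ≤ m → p i ≤ p j)
    (hbd : ∀ i, i ≤ m → p i ≤ n)
    (hpinj : ∀ i, i ≤ m → ∀ j, j ≤ m → p i = p j → i = j)
    (hpsurj : ∀ j, j ≤ n → ∃ i, i ≤ m ∧ p i = j) :
    ∀ i, i ≤ m → p i = i := by
  intro i
  induction i with
  | zero => exact fun _ => hp0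
  | succ i ih =>
    intro hi
    have hpi := ih (by omega)
    have hle := hmono i (i + 1) (by omega) hi
    have hne : p i ≠ p (i + 1) := fun h => by
      have := hpinj i (by omega) (i + 1) hi h
      omega
    have hn := hbd (i + 1) hi
    obtain ⟨j, hj, hpj⟩ := hpsurj (i + 1) (by omega)
    rcases Nat.lt_or_ge i j with hij | hij
    · have := hmono (i + 1) j hij hj
      omega
    · have := hmono j i hij (by omega)
      omega

/-- If `p` is the identity on `{0, …, m}`, the preimage of `M` is `M ∘ u` wherever the latter is
at most `m`. -/
theorem msPreimage_eq_of_eq_self {X Y : Type*} {m : ℕ} {u : X → Y} {p : ℕ → ℕ}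
    (hp : ∀ i, i ≤ m → p i = i) {M : Y → ℕ} {x : X} (hM : M (u x) ≤ m) :
    msPreimage m u p M x = M (u x) := by
  have hset : {i : ℕ | i ≤ m ∧ p i = M (u x)} = {M (u x)} := by
    ext i
    constructor
    · rintro ⟨hi, h⟩
      exact (hp i hi).symm.trans h
    · rintro rfl
      exact ⟨hM, hp _ hM⟩
  rw [msPreimage, hset, csSup_singleton]

/-- For a multiset mapping `f = (u, p) : X^m → Y^n` with `p` a
bijection from `m*` onto `n*`, and `M ∈ Y^n`:
`f⁻¹(Mᶜ) = (f⁻¹(M))ᶜ`, i.e. `∀ x, f⁻¹(Mᶜ)(x) = m − f⁻¹(M)(x)` with `Mᶜ(y) = n − M(y)`. -/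
theorem stmt_13 {X Y : Type*} (m n : ℕ) (u : X → Y) (p : ℕ → ℕ)
    (hp0 : p 0 = 0) (hpm : p m = n)
    (hmono : ∀ i j, i ≤ j → j ≤ m → p i ≤ p j)
    (hbd : ∀ i, i ≤ m → p i ≤ n)
    (hpinj : ∀ i, i ≤ m → ∀ j, j ≤ m → p i = p j → i = j)
    (hpsurj : ∀ j, j ≤ n → ∃ i, i ≤ m ∧ p i = j)
    (M : Y → ℕ) (hM : ∀ y, M y ≤ n) :
    ∀ x : X, msPreimage m u p (fun y => n - M y) x = m - msPreimage m u p M x := by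
  intro x
  have hp := eq_self_of_monotone_bijective hp0 hmono hbd hpinj hpsurj
  obtain rfl : m = n := (hp m le_rfl).symm.trans hpm
  rw [msPreimage_eq_of_eq_self hp (hM _)]
  exact msPreimage_eq_of_eq_self (M := fun y => m - M y) hp (Nat.sub_le _ _)
end
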